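/- Let G be a countable group such that for every ε' > 0 and every finite K' ⊆ G there exists a finite (K', ε')-invariant subset of G (i.e., G is amenable). Let 0 < ε < 1 and 0 < δ < ε³/250. Suppose G acts non-singularly and setwise freely on a probability space (X, 𝓕, μ), and K ⊆ G is finite, symmetric, and contains the identity. If T ⊆ G is a (K, δ)-invariant tile of G, then there exists a measurable T-set W ⊆ X such that μ(TW) > 1 − ε and μ((∂_K T)W) < ε, where TW = ⋃_{t∈T} tW and (∂_K T)W = ⋃_{t∈∂_K T} tW. -/

import Mathlib

open MeasureTheory
open scoped Pointwise ENNReal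

/-- The *`K`-boundary* of `H`: the set of `g ∈ G` such that `Kg` meets both `H` and its
complement. -/
def kBoundary {G : Type*} [Group G] (K H : Set G) : Set G :=
  {g : G | (∃ k ∈ K, k * g ∈ H) ∧ ∃ k ∈ K, k * g ∉ H}

/-- A finite set `H ⊆ G` is *`(K, ε)`-invariant* if its `K`-boundary has fewer than `ε * |H|`
elements. -/
def KInvariant {G : Type*} [Group G] (K : Finset G) (ε : ℝ) (H : Finset G) : Prop :=
  ((kBoundary (K : Set G) (H : Set G)).ncard : ℝ) < ε * H.card

/-- A finite subset `T` *tiles* `G` if there is a set of centres `C` such that the right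
translates `Tc`, `c ∈ C`, partition `G`. -/
def IsTile {G : Type*} [Group G] (T : Finset G) : Prop :=
  ∃ C : Set G,
    (C.PairwiseDisjoint fun c => (fun t => t * c) '' (T : Set G)) ∧
    (⋃ c ∈ C, (fun t => t * c) '' (T : Set G)) = Set.univ

/-- An action of `G` on a measure space is *setwise free* if for every `g ≠ 1` and every
measurable set `A` of positive measure there is a positive-measure measurable `B ⊆ A` with
`μ (gB ∆ B) > 0`. -/
def SetwiseFree (G : Type*) {X : Type*} [Group G] [MulAction G X] [MeasurableSpace X]
    (μ : Measure X) : Prop :=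
  ∀ g : G, g ≠ 1 → ∀ A : Set X, MeasurableSet A → 0 < μ A →
    ∃ B : Set X, B ⊆ A ∧ MeasurableSet B ∧ 0 < μ B ∧ 0 < μ (symmDiff (g • B) B)

/-- A measurable action is *non-singular* if each group element acts measurably and
preserves nullity of measurable sets. -/
def NonSingularAction (G : Type*) {X : Type*} [Group G] [MulAction G X] [MeasurableSpace X]
    (μ : Measure X) : Prop :=
  (∀ g : G, Measurable fun x : X => g • x) ∧
  ∀ (g : G) (A : Set X), MeasurableSet A → (μ A = 0 ↔ μ (g⁻¹ • A) = 0)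

/-- A set `W` is an *`H`-set* if its images under distinct elements of `H` are almost
disjoint. -/
def IsHSet {G X : Type*} [Group G] [MulAction G X] [MeasurableSpace X]
    (μ : Measure X) (H : Set G) (W : Set X) : Prop :=
  ∀ h ∈ H, ∀ h' ∈ H, h ≠ h' → μ ((h • W) ∩ (h' • W)) = 0

theorem exists_disjoint_smul_subset {G X : Type*} [Group G] [MulAction G X]
    [MeasurableSpace X] [MeasurableConstSMul G X] {μ : Measure X}
    (hns : ∀ (g : G) (A : Set X), MeasurableSet A → μ A = 0 → μ (g • A) = 0)
    (hfree : SetwiseFree G μ) (L : Finset G) (hL : 1 ∉ L) {A : Set X}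
    (hA : MeasurableSet A) (hA0 : 0 < μ A) :
    ∃ B ⊆ A, MeasurableSet B ∧ 0 < μ B ∧ ∀ g ∈ L, Disjoint (g • B) B := by
  classical
  induction L using Finset.induction_on with
  | empty => exact ⟨A, subset_rfl, hA, hA0, by simp⟩
  | insert g L _ ih =>
    simp only [Finset.mem_insert, not_or] at hL
    obtain ⟨B, hBA, hB, hB0, hBL⟩ := ih hL.2
    obtain ⟨B', hB'B, hB', -, hsymm⟩ := hfree g (Ne.symm hL.1) B hB hB0
    have key : ∃ D ⊆ B', MeasurableSet D ∧ 0 < μ D ∧ Disjoint (g • D) D := by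
      by_cases h : 0 < μ (B' \ g • B')
      · refine ⟨_, Set.sdiff_subset, hB'.diff (hB'.const_smul g), h, ?_⟩
        exact Set.disjoint_sdiff_right.mono_left (Set.smul_set_mono Set.sdiff_subset)
      · have h' : 0 < μ (g • B' \ B') := by
          refine pos_iff_ne_zero.2 fun h0 => hsymm.ne' ?_
          exact measure_union_null h0 (by simpa using h)
        have heq : g • (B' \ g⁻¹ • B') = g • B' \ B' := by
          rw [Set.smul_set_sdiff, smul_inv_smul]
        have hD : MeasurableSet (B' \ g⁻¹ • B') := hB'.diff (hB'.const_smul g⁻¹)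
        refine ⟨_, Set.sdiff_subset, hD, ?_, ?_⟩
        · refine pos_iff_ne_zero.2 fun h0 => h'.ne' ?_
          rw [← heq]
          exact hns g _ hD h0
        · rw [heq]
          exact Set.disjoint_sdiff_left.mono_right Set.sdiff_subset
    obtain ⟨D, hDB', hD, hD0, hgD⟩ := key
    refine ⟨D, hDB'.trans (hB'B.trans hBA), hD, hD0, ?_⟩
    intro k hk
    rcases Finset.mem_insert.1 hk with rfl | hk
    · exact hgD
    · exact (hBL k hk).mono (Set.smul_set_mono (hDB'.trans hB'B)) (hDB'.trans hB'B)

theorem exists_seq_ae_cover {X : Type*} [MeasurableSpace X] (μ : Measure X) [IsFiniteMeasure μ]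
    {P : Set X → Prop} (hempty : P ∅) (hmono : ∀ {s t : Set X}, s ⊆ t → P t → P s)
    (hP : ∀ A, MeasurableSet A → 0 < μ A → ∃ B ⊆ A, MeasurableSet B ∧ 0 < μ B ∧ P B) :
    ∃ B : ℕ → Set X, (∀ n, MeasurableSet (B n)) ∧ (∀ n, P (B n)) ∧
      Pairwise (Function.onFun Disjoint B) ∧ μ (⋃ n, B n)ᶜ = 0 := by
  let S : Set ℝ≥0∞ := {r | ∃ B : ℕ → Set X, (∀ n, MeasurableSet (B n)) ∧ (∀ n, P (B n)) ∧
    r = μ (⋃ n, B n)}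
  have hS : S.Nonempty := ⟨_, fun _ => ∅, fun _ => .empty, fun _ => hempty, rfl⟩
  obtain ⟨u, -, hu, huS⟩ := exists_seq_tendsto_sSup hS (OrderTop.bddAbove S)
  choose B hBm hBP hBu using huS
  let D : ℕ → Set X := fun n => B n.unpair.1 n.unpair.2
  have hDm : ∀ n, MeasurableSet (D n) := fun n => hBm _ _
  have hDP : ∀ n, P (D n) := fun n => hBP _ _
  have hle : sSup S ≤ μ (⋃ n, D n) := by
    refine le_of_tendsto' hu fun k => ?_
    rw [hBu k]
    refine measure_mono (Set.iUnion_subset fun n => ?_)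
    refine Set.subset_iUnion_of_subset (Nat.pair k n) ?_
    simp [D]
  refine ⟨disjointed D, fun n => MeasurableSet.disjointed hDm n,
    fun n => hmono (disjointed_subset D n) (hDP n), disjoint_disjointed D, ?_⟩
  rw [iUnion_disjointed]
  by_contra h0
  have hDU : MeasurableSet (⋃ n, D n) := MeasurableSet.iUnion hDm
  obtain ⟨E, hEs, hEm, hE0, hEP⟩ := hP _ hDU.compl (pos_iff_ne_zero.2 h0)
  let D' : ℕ → Set X := fun n => Nat.casesOn n E D
  have hD' : ⋃ n, D' n = E ∪ ⋃ n, D n := by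
    ext x
    simp only [Set.mem_iUnion, Set.mem_union]
    constructor
    · rintro ⟨_ | n, hn⟩
      exacts [.inl hn, .inr ⟨n, hn⟩]
    · rintro (h | ⟨n, hn⟩)
      exacts [⟨0, h⟩, ⟨n + 1, hn⟩]
  have hmem : μ (⋃ n, D' n) ∈ S := by
    refine ⟨D', ?_, ?_, rfl⟩
    · rintro (_ | n)
      exacts [hEm, hDm n]
    · rintro (_ | n)
      exacts [hEP, hDP n]
  have h1 := (le_sSup hmem).trans hle
  rw [hD', measure_union (Set.disjoint_left.2 fun x hx => hEs hx) hDU] at h1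
  have := ENNReal.lt_add_right (measure_ne_top μ (⋃ n, D n)) hE0.ne'
  rw [add_comm] at this
  exact absurd h1 (not_le.2 this)

theorem exists_greedy_selection {X : Type*} [MeasurableSpace X] (μ : Measure X)
    [IsProbabilityMeasure μ] {V : ℕ → Set X} (hV : ∀ n, MeasurableSet (V n))
    (c : ℕ → ℝ≥0∞) (η : ℝ≥0∞) :
    ∃ J : Set ℕ, (∑' n, J.indicator c n) ≤ η ∧
      ∀ n, n ∉ J → η * μ (V n \ ⋃ i ∈ J, V i) ≤ c n := by
  classical
  let U : ℕ → Set X := fun n => Nat.rec ∅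
    (fun n Un => if c n ≤ η * μ (V n \ Un) then Un ∪ V n else Un) n
  have hU : ∀ n, U (n + 1) = if c n ≤ η * μ (V n \ U n) then U n ∪ V n else U n := fun _ => rfl
  let J : Set ℕ := {n | c n ≤ η * μ (V n \ U n)}
  refine ⟨J, ?_, ?_⟩
  · have key : ∀ n, ∑ i ∈ Finset.range n, J.indicator c i ≤ η * μ (U n) := by
      intro n
      induction n with
      | zero => simp
      | succ n ih =>
        rw [Finset.sum_range_succ, hU]
        split_ifs with h
        · rw [Set.indicator_of_mem (show n ∈ J from h), ← Set.union_sdiff_self,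
            measure_union' Set.disjoint_sdiff_right]
          · rw [mul_add]
            exact add_le_add ih h
          · clear ih h
            induction n with
            | zero => exact .empty
            | succ n ih =>
              rw [hU]
              split_ifs
              exacts [ih.union (hV n), ih]
        · rw [Set.indicator_of_notMem (show n ∉ J from h), add_zero]
          exact ih
    refine ENNReal.tsum_le_of_sum_range_le fun n => (key n).trans ?_
    exact mul_le_of_le_one_right' prob_le_one
  · intro n hn
    refine le_trans ?_ (not_le.1 hn).le
    gcongr
    intro x hx
    clear hn
    induction n with
    | zero => exact hx.elim
    | succ n ih =>
      rw [hU] at hx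
      split_ifs at hx with h
      · rcases hx with hx | hx
        exacts [ih hx, Set.mem_biUnion (show n ∈ J from h) hx]
      · exact ih hx

theorem exists_towers {G X : Type*} [Group G] [MulAction G X]
    [MeasurableSpace X] [MeasurableConstSMul G X] {μ : Measure X} [IsProbabilityMeasure μ]
    (hns : ∀ (g : G) (A : Set X), MeasurableSet A → μ A = 0 → μ (g • A) = 0)
    (hfree : SetwiseFree G μ) (F F' : Finset G) (η : ℝ≥0∞) :
    ∃ A : ℕ → Set X, (∀ n, MeasurableSet (A n)) ∧
      (∀ n, (F : Set G).PairwiseDisjoint fun f => f • A n) ∧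
      ∑' n, μ ((F' : Set G) • A n) ≤ η ∧
      η * (F.card * μ (⋃ n, (F : Set G) • A n)ᶜ) ≤ F'.card := by
  classical
  obtain ⟨B, hBm, hBF, hBd, hB0⟩ := exists_seq_ae_cover μ
    (P := fun B => (F : Set G).PairwiseDisjoint fun f => f • B)
    (by intro f _ f' _ _; simp [Function.onFun])
    (fun {s t} hst ht f hf f' hf' hne => (ht hf hf' hne).mono
      (Set.smul_set_mono hst) (Set.smul_set_mono hst))
    (by
      intro A hA hA0
      obtain ⟨B, hBA, hB, hB0, hBL⟩ := exists_disjoint_smul_subset hns hfree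
        ((F⁻¹ * F).erase 1) (Finset.notMem_erase _ _) hA hA0
      refine ⟨B, hBA, hB, hB0, fun f hf f' hf' hne => ?_⟩
      have := hBL (f⁻¹ * f') (Finset.mem_erase.2 ⟨by rwa [ne_eq, inv_mul_eq_one],
        Finset.mul_mem_mul (Finset.inv_mem_inv hf) hf'⟩)
      rw [← Set.disjoint_smul_set (a := f), smul_smul, mul_inv_cancel_left] at this
      exact this.symm)
  have htot : ∀ (g : G) (s : Set X), MeasurableSet s → ∑' n, μ (g • B n \ s) = μ sᶜ := by
    intro g s hs
    rw [← measure_iUnion]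
    · refine le_antisymm (measure_mono ?_) ?_
      · exact Set.iUnion_subset fun n x hx => hx.2
      · have h0 := hns g _ (MeasurableSet.iUnion hBm).compl hB0
        calc μ sᶜ ≤ μ ((⋃ n, g • B n \ s) ∪ g • (⋃ n, B n)ᶜ) := by
              refine measure_mono fun x hx => ?_
              by_cases h : g⁻¹ • x ∈ ⋃ n, B n
              · obtain ⟨n, hn⟩ := Set.mem_iUnion.1 h
                exact .inl (Set.mem_iUnion.2 ⟨n, Set.mem_smul_set_iff_inv_smul_mem.2 hn, hx⟩)
              · exact .inr (Set.mem_smul_set_iff_inv_smul_mem.2 h)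
          _ ≤ _ := (measure_union_le _ _).trans (by rw [h0, add_zero])
    · intro i j hij
      exact (Set.disjoint_smul_set.2 (hBd hij)).mono Set.sdiff_subset Set.sdiff_subset
    · exact fun n => ((hBm n).const_smul g).diff hs
  have hFm : ∀ n, MeasurableSet ((F : Set G) • B n) := by
    intro n
    rw [← Set.iUnion_smul_set]
    exact F.measurableSet_biUnion fun f _ => (hBm n).const_smul f
  obtain ⟨J, hJη, hJ⟩ := exists_greedy_selection μ hFm (fun n => ∑ g ∈ F', μ (g • B n)) η
  refine ⟨fun n => if n ∈ J then B n else ∅, fun n => ?_, fun n => ?_, ?_, ?_⟩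
  · dsimp only
    split_ifs
    exacts [hBm n, .empty]
  · dsimp only
    split_ifs
    · exact hBF n
    · intro f _ f' _ _; simp [Function.onFun]
  · refine le_trans (ENNReal.tsum_le_tsum fun n => ?_) hJη
    by_cases hn : n ∈ J
    · simp only [hn, if_true, Set.indicator_of_mem]
      rw [← Set.iUnion_smul_set]
      exact measure_biUnion_finset_le F' _
    · simp [hn]
  · have hU : (⋃ n, (F : Set G) • (if n ∈ J then B n else ∅)) = ⋃ n ∈ J, (F : Set G) • B n := by
      refine Set.iUnion_congr fun n => ?_
      by_cases hn : n ∈ J <;> simp [hn]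
    rw [hU]
    set U := ⋃ n ∈ J, (F : Set G) • B n with hUdef
    have hUm : MeasurableSet U := .biUnion J.to_countable fun n _ => hFm n
    have hle : ∀ n, η * μ ((F : Set G) • B n \ U) ≤ ∑ g ∈ F', μ (g • B n) := by
      intro n
      by_cases hn : n ∈ J
      · rw [Set.sdiff_eq_empty.2 (Set.subset_biUnion_of_mem (u := fun n => (F : Set G) • B n) hn)]
        simp
      · exact hJ n hn
    calc η * (F.card * μ Uᶜ) = η * ∑' n, μ ((F : Set G) • B n \ U) := by
          congr 1
          have : ∀ n, μ ((F : Set G) • B n \ U) = ∑ f ∈ F, μ (f • B n \ U) := by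
            intro n
            simp only [← Set.iUnion_smul_set, Set.iUnion_sdiff]
            refine measure_biUnion_finset (fun f hf f' hf' hne => ?_) fun f _ =>
              ((hBm n).const_smul f).diff hUm
            exact (hBF n hf hf' hne).mono Set.sdiff_subset Set.sdiff_subset
          simp_rw [this]
          rw [Summable.tsum_finsetSum fun _ _ => ENNReal.summable]
          simp [htot _ U hUm]
      _ = ∑' n, η * μ ((F : Set G) • B n \ U) := ENNReal.tsum_mul_left.symm
      _ ≤ ∑' n, ∑ g ∈ F', μ (g • B n) := ENNReal.tsum_le_tsum hle
      _ = ∑ g ∈ F', ∑' n, μ (g • B n) :=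
          Summable.tsum_finsetSum fun _ _ => ENNReal.summable
      _ = F'.card := by
          have := fun g => htot g ∅ .empty
          simp only [Set.sdiff_empty, Set.compl_empty, measure_univ] at this
          simp [this]

theorem exists_disjoint_tile_translates_of_towers {G X : Type*} [Group G] [Countable G]
    [MulAction G X] [MeasurableSpace X] [MeasurableConstSMul G X] {Q T F : Finset G}
    (hTQ : T ⊆ Q) {P : Set G} (hcover : ∀ g, ∃ t ∈ T, ∃ c ∈ P, t * c = g)
    (hinj : ∀ t ∈ T, ∀ c ∈ P, ∀ t' ∈ T, ∀ c' ∈ P, t * c = t' * c' → c = c')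
    {A : ℕ → Set X} (hA : ∀ n, MeasurableSet (A n))
    (hAF : ∀ n, (F : Set G).PairwiseDisjoint fun f => f • A n) :
    ∃ W : Set X, MeasurableSet W ∧ (T : Set G).PairwiseDisjoint (fun t => t • W) ∧
      (⋃ n, (F : Set G) • A n) ⊆ (⋃ t ∈ T, t • W) ∪
        ⋃ n, kBoundary ((Q : Set G) * (T : Set G)⁻¹) (F : Set G) • A n ∧
      ∀ b ∈ Q, ∀ x ∈ W, ∃ c ∈ P, b * c ∈ F ∧
        b • x ∈ ⋃ n, (b * c) • A n \ ⋃ i < n, (F : Set G) • A i := by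
  classical
  have hFA : ∀ n, MeasurableSet (⋃ i < n, (F : Set G) • A i) := by
    intro n
    refine .biUnion (Set.to_countable _) fun i _ => ?_
    rw [← Set.iUnion_smul_set]
    exact F.measurableSet_biUnion fun f _ => (hA i).const_smul f
  let W : Set X := {x | ∃ n, ∃ c ∈ P, (∀ h ∈ Q, h * c ∈ F) ∧ x ∈ c • A n ∧
    ∀ h ∈ Q, h • x ∉ ⋃ i < n, (F : Set G) • A i}
  have hW : ∀ b ∈ Q, ∀ x ∈ W, ∃ n, ∃ c ∈ P, b * c ∈ F ∧
      b • x ∈ (b * c) • A n ∧ b • x ∉ ⋃ i < n, (F : Set G) • A i := by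
    rintro b hb x ⟨n, c, hc, hQ, hx, hxU⟩
    refine ⟨n, c, hc, hQ b hb, ?_, hxU b hb⟩
    rw [mul_smul]
    exact Set.smul_mem_smul_set hx
  refine ⟨W, ?_, ?_, ?_, ?_⟩
  · have : W = ⋃ n, ⋃ c ∈ {c ∈ P | ∀ h ∈ Q, h * c ∈ F}, (c • A n ∩
        ⋂ h ∈ Q, (fun x => h • x) ⁻¹' (⋃ i < n, (F : Set G) • A i)ᶜ) := by
      ext x
      simp only [W, Set.mem_ofPred_eq, Set.mem_iUnion, Set.mem_inter_iff, Set.mem_iInter,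
        Set.mem_preimage, Set.mem_compl_iff, exists_prop]
      exact exists_congr fun n => exists_congr fun c => by tauto
    rw [this]
    refine .iUnion fun n => .biUnion (Set.to_countable _) fun c _ => ?_
    refine ((hA n).const_smul c).inter (Q.measurableSet_biInter fun h _ => ?_)
    exact measurable_const_smul h (hFA n).compl
  · intro t ht t' ht' hne
    refine Set.disjoint_left.2 ?_
    rintro _ ⟨x, hx, rfl⟩ ⟨x', hx', hxx'⟩
    obtain ⟨n, c, hc, hcF, h1, h2⟩ := hW t (hTQ ht) x hx
    obtain ⟨n', c', hc', hcF', h1', h2'⟩ := hW t' (hTQ ht') x' hx'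
    dsimp only at hxx'
    rw [hxx'] at h1' h2'
    have hn : n = n' := by
      rcases lt_trichotomy n n' with h | h | h
      · exact (h2' (Set.mem_biUnion (t := fun i => (F : Set G) • A i) h
          (Set.smul_set_subset_smul hcF h1))).elim
      · exact h
      · exact (h2 (Set.mem_biUnion (t := fun i => (F : Set G) • A i) h
          (Set.smul_set_subset_smul hcF' h1'))).elim
    subst hn
    have heq : t * c = t' * c' := by
      by_contra hcc
      exact Set.disjoint_left.1 (hAF n hcF hcF' hcc) h1 h1'
    have := hinj t ht c hc t' ht' c' hc' heq
    subst this
    exact hne (mul_right_cancel heq)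
  · intro x hx
    by_cases hxb : x ∈ ⋃ n, kBoundary ((Q : Set G) * (T : Set G)⁻¹) (F : Set G) • A n
    · exact .inr hxb
    refine .inl ?_
    have hx' : ∃ n, x ∈ (F : Set G) • A n := Set.mem_iUnion.1 hx
    have hmin := fun i (hi : i < Nat.find hx') => Nat.find_min hx' hi
    obtain ⟨f, hf, y, hy, hfy⟩ := Nat.find_spec hx'
    set n := Nat.find hx'
    dsimp only at hfy
    obtain ⟨t, ht, c, hc, rfl⟩ := hcover f
    have h1D : (1 : G) ∈ (Q : Set G) * (T : Set G)⁻¹ :=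
      ⟨t, hTQ ht, t⁻¹, Set.inv_mem_inv.2 ht, mul_inv_cancel t⟩
    have hD : ∀ h ∈ Q, h * t⁻¹ ∈ (Q : Set G) * (T : Set G)⁻¹ := fun h hh =>
      Set.mul_mem_mul hh (Set.inv_mem_inv.2 ht)
    have hnb : ∀ i, ∀ g, ∀ z ∈ A i, g • z = x →
        g ∉ kBoundary ((Q : Set G) * (T : Set G)⁻¹) (F : Set G) := fun i g z hz hgz hg =>
      hxb (Set.mem_iUnion.2 ⟨i, g, hg, z, hz, hgz⟩)
    refine Set.mem_biUnion ht ⟨c • y, ⟨n, c, hc, ?_, Set.smul_mem_smul_set hy, ?_⟩, ?_⟩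
    · intro h hh
      by_contra hcon
      refine hnb n _ y hy hfy ⟨⟨1, h1D, by simpa using hf⟩, h * t⁻¹, hD h hh, ?_⟩
      simpa [mul_assoc] using hcon
    · intro h hh hcon
      simp only [Set.mem_iUnion] at hcon
      obtain ⟨i, hi, f', hf', z, hz, hfz⟩ := hcon
      dsimp only at hfz
      have hgz : ((h * t⁻¹)⁻¹ * f') • z = x := by
        rw [mul_smul, hfz, ← hfy]
        simp [mul_smul]
      refine hnb i _ z hz hgz ⟨⟨h * t⁻¹, hD h hh, by rwa [mul_inv_cancel_left]⟩, 1, h1D, fun hF => ?_⟩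
      rw [one_mul] at hF
      exact hmin i hi ⟨_, hF, z, hz, hgz⟩
    · simpa [mul_smul] using hfy
  · intro b hb x hx
    obtain ⟨n, c, hc, h1, h2, h3⟩ := hW b hb x hx
    exact ⟨c, hc, h1, Set.mem_iUnion.2 ⟨n, h2, h3⟩⟩

theorem exists_finset_card_mul_le {G : Type*} [Group G] [DecidableEq G]
    (hamen : ∀ ε' : ℝ, 0 < ε' → ∀ K' : Finset G, ∃ H : Finset G, KInvariant K' ε' H)
    (E : Finset G) : ∃ S : Finset G, S.Nonempty ∧ (E * S).card ≤ 2 * S.card := by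
  obtain ⟨S, hS⟩ := hamen 1 one_pos (insert 1 E⁻¹)
  rw [KInvariant, one_mul, Nat.cast_lt] at hS
  refine ⟨S, Finset.card_pos.1 (Nat.zero_le _ |>.trans_lt hS), ?_⟩
  have hsub : ((E * S : Finset G) : Set G) ⊆ (S : Set G) ∪
      kBoundary ((insert 1 E⁻¹ : Finset G) : Set G) (S : Set G) := by
    rw [Finset.coe_mul]
    rintro _ ⟨e, he, s, hs, rfl⟩
    by_cases h : e * s ∈ (S : Set G)
    · exact .inl h
    · exact .inr ⟨⟨e⁻¹, by simp [Finset.mem_coe.1 he], by simpa using hs⟩, 1, by simp,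
        by simpa using h⟩
  have hfin : (kBoundary ((insert 1 E⁻¹ : Finset G) : Set G) (S : Set G)).Finite := by
    refine (((insert 1 E⁻¹)⁻¹ * S : Finset G).finite_toSet).subset ?_
    rintro g ⟨⟨k, hk, hkg⟩, -⟩
    exact Finset.mem_mul.2 ⟨k⁻¹, Finset.inv_mem_inv hk, k * g, hkg, inv_mul_cancel_left k g⟩
  have h1 := Set.ncard_le_ncard hsub (S.finite_toSet.union hfin)
  have h2 := Set.ncard_union_le (S : Set G)
    (kBoundary ((insert 1 E⁻¹ : Finset G) : Set G) (S : Set G))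
  rw [Set.ncard_coe_finset] at h1 h2
  omega

theorem exists_translate_sum_le {G : Type*} [Group G]
    (hamen : ∀ ε' : ℝ, 0 < ε' → ∀ K' : Finset G, ∃ H : Finset G, KInvariant K' ε' H)
    (T N F : Finset G) {C : Set G} (hinj : ∀ t ∈ T, ∀ c ∈ C, ∀ t' ∈ T, ∀ c' ∈ C,
      t * c = t' * c' → c = c') {m : G → ℝ} (hm : ∀ g, 0 ≤ m g) :
    ∃ s : G, T.card * (∑ f ∈ F, {f | f * s ∈ (N : Set G) * C}.indicator m f) ≤
      2 * N.card * ∑ f ∈ F, m f := by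
  classical
  obtain ⟨S, hS, hES⟩ := exists_finset_card_mul_le hamen (F⁻¹ * (T * N⁻¹ * F))
  have hcount : ∀ f ∈ F, T.card * (S.filter fun s => f * s ∈ (N : Set G) * C).card ≤
      2 * N.card * S.card := by
    intro f hf
    let Z := (N⁻¹ * ({f} * S)).filter (· ∈ C)
    have h1 : (S.filter fun s => f * s ∈ (N : Set G) * C).card ≤ (N * Z).card := by
      refine Finset.card_le_card_of_injOn (f * ·) ?_ (mul_right_injective f).injOn
      intro s hs
      obtain ⟨hs, b, hb, c, hc, hbc⟩ := Finset.mem_filter.1 hs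
      refine Finset.mem_mul.2 ⟨b, hb, c, Finset.mem_filter.2 ⟨?_, hc⟩, hbc⟩
      refine Finset.mem_mul.2 ⟨b⁻¹, Finset.inv_mem_inv hb, f * s, ?_, ?_⟩
      · exact Finset.mul_mem_mul (Finset.mem_singleton_self f) hs
      · rw [← hbc]; simp
    have h2 : (T * Z).card = T.card * Z.card := by
      refine Finset.card_mul_iff.2 ?_
      rintro ⟨t, c⟩ ⟨ht, hc⟩ ⟨t', c'⟩ ⟨ht', hc'⟩ h
      have hcc := hinj t ht c (Finset.mem_filter.1 hc).2 t' ht' c' (Finset.mem_filter.1 hc').2 h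
      subst hcc
      simpa using h
    have h3 : (T * Z).card ≤ (F⁻¹ * (T * N⁻¹ * F) * S).card := by
      refine Finset.card_le_card_of_injOn (f⁻¹ * ·) ?_ (mul_right_injective f⁻¹).injOn
      intro g hg
      obtain ⟨t, ht, c, hc, rfl⟩ := Finset.mem_mul.1 hg
      obtain ⟨b, hb, q, hq, rfl⟩ := Finset.mem_mul.1 (Finset.mem_filter.1 hc).1
      obtain ⟨f', hf', s, hs, rfl⟩ := Finset.mem_mul.1 hq
      rw [Finset.mem_singleton] at hf'
      subst hf'
      refine Finset.mem_mul.2 ⟨f'⁻¹ * (t * b * f'), ?_, s, hs, by group⟩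
      exact Finset.mul_mem_mul (Finset.inv_mem_inv hf)
        (Finset.mul_mem_mul (Finset.mul_mem_mul ht hb) hf)
    calc T.card * _ ≤ T.card * (N.card * Z.card) :=
          Nat.mul_le_mul_left _ (h1.trans Finset.card_mul_le)
      _ = N.card * (T * Z).card := by rw [h2]; ring
      _ ≤ N.card * (2 * S.card) := Nat.mul_le_mul_left _ (h3.trans hES)
      _ = _ := by ring
  obtain ⟨s, -, hs⟩ := Finset.exists_le_of_sum_le hS (f := fun s => T.card *
    (∑ f ∈ F, {f | f * s ∈ (N : Set G) * C}.indicator m f))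
    (g := fun _ => 2 * N.card * ∑ f ∈ F, m f) (by
      rw [← Finset.mul_sum, Finset.sum_comm, Finset.mul_sum, Finset.sum_const, nsmul_eq_mul,
        Finset.mul_sum, Finset.mul_sum]
      refine Finset.sum_le_sum fun f hf => ?_
      have : ∑ s ∈ S, {f | f * s ∈ (N : Set G) * C}.indicator m f =
          (S.filter fun s => f * s ∈ (N : Set G) * C).card * m f := by
        simp [Set.indicator_apply, Finset.sum_ite]
      rw [this, ← mul_assoc]
      calc _ ≤ ((2 * N.card * S.card : ℕ) : ℝ) * m f := by
            refine mul_le_mul_of_nonneg_right ?_ (hm f)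
            exact_mod_cast hcount f hf
        _ = _ := by push_cast; ring)
  exact ⟨s, hs⟩

theorem finite_kBoundary {G : Type*} [Group G] (K H : Finset G) :
    (kBoundary (K : Set G) (H : Set G)).Finite := by
  refine (K.finite_toSet.inv.mul H.finite_toSet).subset ?_
  rintro g ⟨⟨k, hk, hkg⟩, -⟩
  exact ⟨k⁻¹, Set.inv_mem_inv.2 hk, k * g, hkg, inv_mul_cancel_left k g⟩

theorem IsTile.exists_translate {G : Type*} [Group G] {T : Finset G} (hT : IsTile T) :
    ∃ C : Set G, (∀ g, ∃ t ∈ T, ∃ c ∈ C, t * c = g) ∧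
      ∀ t ∈ T, ∀ c ∈ C, ∀ t' ∈ T, ∀ c' ∈ C, t * c = t' * c' → c = c' := by
  obtain ⟨C, hd, hu⟩ := hT
  refine ⟨C, fun g => ?_, fun t ht c hc t' ht' c' hc' h => ?_⟩
  · have hg : g ∈ ⋃ c ∈ C, (fun t => t * c) '' (T : Set G) := hu ▸ Set.mem_univ g
    obtain ⟨c, hc, t, ht, rfl⟩ := Set.mem_iUnion₂.1 hg
    exact ⟨t, ht, c, hc, rfl⟩
  · by_contra hne
    exact Set.disjoint_left.1 (hd hc hc' hne) ⟨t, ht, rfl⟩ ⟨t', ht', h.symm⟩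

theorem exists_TSet_of_tile {G X : Type*} [Group G] [Countable G] [MulAction G X]
    [MeasurableSpace X] (μ : Measure X) [IsProbabilityMeasure μ]
    (hamen : ∀ ε' : ℝ, 0 < ε' → ∀ K' : Finset G, ∃ H : Finset G, KInvariant K' ε' H)
    (ε δ : ℝ) (hε0 : 0 < ε) (hε1 : ε < 1) (hδ0 : 0 < δ) (hδ : δ < ε ^ 3 / 250)
    (hns : NonSingularAction G μ) (hfree : SetwiseFree G μ)
    (K : Finset G) (hKsymm : ∀ k ∈ K, k⁻¹ ∈ K) (hKone : (1 : G) ∈ K)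
    (T : Finset G) (hT : IsTile T) (hTinv : KInvariant K δ T) :
    ∃ W : Set X, MeasurableSet W ∧ IsHSet μ (T : Set G) W ∧
      ENNReal.ofReal (1 - ε) < μ (⋃ t ∈ T, t • W) ∧
      μ (⋃ g ∈ kBoundary (K : Set G) (T : Set G), g • W) < ENNReal.ofReal ε := by
  classical
  have : MeasurableConstSMul G X := ⟨hns.1⟩
  have hnull : ∀ (g : G) (A : Set X), MeasurableSet A → μ A = 0 → μ (g • A) = 0 := by
    intro g A hA h
    simpa using (hns.2 g⁻¹ A hA).1 h
  obtain ⟨C, hcover, hinj⟩ := hT.exists_translate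
  have hTpos : 0 < T.card := by
    obtain ⟨t, ht, -⟩ := hcover 1
    exact Finset.card_pos.2 ⟨t, ht⟩
  -- a tower shape that is very invariant under `K * T * T⁻¹`
  obtain ⟨F, hF⟩ := hamen (ε ^ 2 / 16) (by positivity) (K * T * T⁻¹)
  have hbF := finite_kBoundary (K * T * T⁻¹) F
  obtain ⟨A, hA, hAF, hAb, hAU⟩ := exists_towers hnull hfree F hbF.toFinset
    (ENNReal.ofReal (ε / 4))
  rw [KInvariant, Set.ncard_eq_toFinset_card _ hbF] at hF
  rw [Set.Finite.coe_toFinset] at hAb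
  have hFpos : 0 < F.card := by
    by_contra h0
    have h0 : F.card = 0 := by omega
    rw [h0, Nat.cast_zero, mul_zero] at hF
    exact absurd hF (not_lt.2 (Nat.cast_nonneg _))
  let M : G → Set X := fun f => ⋃ n, f • A n \ ⋃ i < n, (F : Set G) • A i
  have hFA : ∀ n, MeasurableSet ((F : Set G) • A n) := by
    intro n
    rw [← Set.iUnion_smul_set]
    exact F.measurableSet_biUnion fun f _ => (hA n).const_smul f
  have hMm : ∀ f, MeasurableSet (M f) := fun f => .iUnion fun n =>
    ((hA n).const_smul f).diff (.biUnion (Set.to_countable _) fun i _ => hFA i)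
  have hMd : (F : Set G).PairwiseDisjoint M := by
    intro f hf f' hf' hne
    refine Set.disjoint_left.2 fun x hx hx' => ?_
    obtain ⟨n, hn, hnU⟩ := Set.mem_iUnion.1 hx
    obtain ⟨n', hn', hnU'⟩ := Set.mem_iUnion.1 hx'
    rcases lt_trichotomy n n' with h | h | h
    · exact hnU' (Set.mem_biUnion (t := fun i => (F : Set G) • A i) h
        (Set.smul_set_subset_smul hf hn))
    · subst h
      exact Set.disjoint_left.1 (hAF n hf hf' hne) hn hn'
    · exact hnU (Set.mem_biUnion (t := fun i => (F : Set G) • A i) h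
        (Set.smul_set_subset_smul hf' hn'))
  have hMsum : ∑ f ∈ F, μ.real (M f) ≤ 1 := by
    rw [← measureReal_biUnion_finset hMd fun f _ => hMm f]
    exact measureReal_le_one
  -- a translate of the tiling whose boundary carries little of the towers
  have hbT := finite_kBoundary K T
  rw [KInvariant, Set.ncard_eq_toFinset_card _ hbT] at hTinv
  obtain ⟨s, hs⟩ := exists_translate_sum_le hamen T hbT.toFinset F hinj
    (m := fun f => μ.real (M f)) fun _ => measureReal_nonneg
  obtain ⟨W, hWm, hWT, hWcover, hWb⟩ := exists_disjoint_tile_translates_of_towers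
    (Q := K * T) (T := T) (F := F) (P := {g | g * s ∈ C})
    (fun t ht => by simpa using Finset.mul_mem_mul hKone ht)
    (fun g => by
      obtain ⟨t, ht, c, hc, h⟩ := hcover (g * s)
      exact ⟨t, ht, c * s⁻¹, by simpa using hc, by rw [← mul_assoc, h, mul_inv_cancel_right]⟩)
    (fun t ht c hc t' ht' c' hc' h => mul_right_cancel
      (hinj t ht (c * s) hc t' ht' (c' * s) hc' (by rw [← mul_assoc, h, mul_assoc])))
    hA hAF
  refine ⟨W, hWm, fun h hh h' hh' hne => ?_, ?_, ?_⟩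
  · rw [Set.disjoint_iff_inter_eq_empty.1 (hWT hh hh' hne), measure_empty]
  · have hUm : MeasurableSet (⋃ n, (F : Set G) • A n) := .iUnion hFA
    have h1 : μ.real (⋃ n, (F : Set G) • A n)ᶜ ≤ ε / 4 := by
      have := ENNReal.toReal_mono (ENNReal.natCast_ne_top _) hAU
      rw [ENNReal.toReal_mul, ENNReal.toReal_mul, ENNReal.toReal_ofReal (by positivity),
        ENNReal.toReal_natCast, ENNReal.toReal_natCast] at this
      have h2 := this.trans hF.le
      have hFpos' : (0 : ℝ) < F.card := by exact_mod_cast hFpos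
      change ε / 4 * (F.card * μ.real _) ≤ _ at h2
      have h3 : (ε / 4 * F.card) * μ.real (⋃ n, (F : Set G) • A n)ᶜ ≤
          (ε / 4 * F.card) * (ε / 4) := by linarith
      exact le_of_mul_le_mul_left h3 (by positivity)
    rw [measureReal_compl hUm, probReal_univ] at h1
    have h2 : μ.real (⋃ n, kBoundary (((K * T : Finset G) : Set G) * (T : Set G)⁻¹) (F : Set G) • A n) ≤
        ε / 4 := by
      refine ENNReal.toReal_le_of_le_ofReal (by positivity) ?_
      refine (measure_iUnion_le _).trans ?_
      rwa [Finset.coe_mul, Finset.coe_inv] at hAb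
    have h3 := (measureReal_mono (μ := μ) hWcover).trans (measureReal_union_le _ _)
    refine (ENNReal.ofReal_lt_iff_lt_toReal (by linarith) (measure_ne_top _ _)).2 ?_
    change _ < μ.real _
    linarith
  · have hsub : (⋃ g ∈ kBoundary (K : Set G) (T : Set G), g • W) ⊆
        ⋃ f ∈ F.filter (fun f => f * s ∈ (hbT.toFinset : Set G) * C), M f := by
      refine Set.iUnion₂_subset fun b hb => ?_
      rintro _ ⟨x, hx, rfl⟩
      obtain ⟨k, hk, hkb⟩ := hb.1
      have hbQ : b ∈ K * T := by
        simpa using Finset.mul_mem_mul (hKsymm k hk) hkb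
      obtain ⟨c, hc, hcF, hx'⟩ := hWb b hbQ x hx
      refine Set.mem_biUnion (Finset.mem_filter.2 ⟨hcF, ?_⟩) hx'
      exact ⟨b, by simpa using hb, c * s, hc, (mul_assoc _ _ _).symm⟩
    have h1 := (measureReal_mono (μ := μ) hsub (measure_ne_top _ _)).trans
      (measureReal_biUnion_finset_le _ _)
    rw [Finset.sum_filter] at h1
    simp only [Set.indicator_apply, Set.mem_ofPred_eq] at hs
    refine (ENNReal.lt_ofReal_iff_toReal_lt (measure_ne_top _ _)).2 ?_
    refine lt_of_le_of_lt h1 ?_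
    have hTpos' : (0 : ℝ) < T.card := by exact_mod_cast hTpos
    have hδε : 2 * δ < ε := by
      have : ε ^ 3 ≤ ε := pow_le_of_le_one hε0.le hε1.le (by norm_num)
      linarith
    refine lt_of_mul_lt_mul_left (hs.trans_lt ?_) hTpos'.le
    calc _ ≤ 2 * (hbT.toFinset.card : ℝ) * 1 := by gcongr
      _ < T.card * ε := by nlinarith
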